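/- arXiv:1909.12872 — 2 statements merged into one kernel-verified Lean document; each statement's English description precedes it below -/
import Mathlib

section
/- Let f : X → Y be a finite universal homeomorphism between varieties over a perfect field k of characteristic p > 0. Then f factors through some power of the absolute Frobenius; i.e., there exists e > 0 and a morphism g : Y → X such that f ∘ g equals the e-th power of the Frobenius endomorphism of Y. -/
/-!
STATEMENT 0: Let `f : X → Y` be a finite universal homeomorphism between varieties
(integral, separated schemes of finite type) over a perfect field `k` of characteristic
`p > 0`.  Then `f` factors through a power of the absolute Frobenius of `Y`: there exist
`e > 0` and a morphism `g : Y ⟶ X` with `g ≫ f` equal to the `e`-th power of the absolute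
Frobenius of `Y` (identity on points, `p^e`-th power on sections).
-/

open AlgebraicGeometry CategoryTheory

universe u

/-- A morphism of schemes is a *universal homeomorphism* if every base change of it is a
homeomorphism on underlying topological spaces. -/
def IsUniversalHomeomorphism : MorphismProperty Scheme.{u} :=
  (AlgebraicGeometry.topologically fun f => IsHomeomorph f).universally

/-- `h : Y ⟶ Y` is the `e`-th power of the absolute Frobenius (in characteristic `p`):
it is the identity on the underlying topological space and raises sections over every
open subset to the `p ^ e`-th power. -/
structure IsPowerOfFrobenius (p e : ℕ) {Y : Scheme.{u}} (h : Y ⟶ Y) : Prop where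
  base_eq : ∀ x : Y, h.base x = x
  le : ∀ U : Y.Opens, U ≤ h ⁻¹ᵁ U
  app_eq : ∀ (U : Y.Opens) (s : Γ(Y, U)), h.appLE U U (le U) s = s ^ p ^ e

/-- The elements of `B` some `p`-power power of which lies in the image of `A`. -/
def frobeniusClosure (p : ℕ) [Fact p.Prime] (A B : Type*) [CommRing A] [CommRing B] [Algebra A B]
    [CharP B p] : Subalgebra A B where
  carrier := {b | ∃ n, b ^ p ^ n ∈ (algebraMap A B).range}
  mul_mem' := by
    rintro x y ⟨m, hm⟩ ⟨n, hn⟩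
    refine ⟨m + n, ?_⟩
    rw [mul_pow]
    refine mul_mem ?_ ?_
    · rw [pow_add, pow_mul]
      exact pow_mem hm _
    · rw [add_comm, pow_add, pow_mul]
      exact pow_mem hn _
  add_mem' := by
    rintro x y ⟨m, hm⟩ ⟨n, hn⟩
    refine ⟨m + n, ?_⟩
    rw [add_pow_char_pow]
    refine add_mem ?_ ?_
    · rw [pow_add, pow_mul]
      exact pow_mem hm _
    · rw [add_comm, pow_add, pow_mul]
      exact pow_mem hn _
  algebraMap_mem' a := ⟨0, by simp⟩

lemma mem_frobeniusClosure_of_pow_mem {p : ℕ} [Fact p.Prime] {A B : Type*} [CommRing A]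
    [CommRing B] [Algebra A B] [CharP B p] {b : B} {n : ℕ}
    (h : b ^ p ^ n ∈ frobeniusClosure p A B) : b ∈ frobeniusClosure p A B := by
  obtain ⟨m, hm⟩ := h
  exact ⟨n + m, by rwa [pow_add, pow_mul]⟩

/-- The largest ideal of `B` contained in a subalgebra. -/
def Subalgebra.conductor {A B : Type*} [CommRing A] [CommRing B] [Algebra A B]
    (D : Subalgebra A B) : Ideal B where
  carrier := {x | ∀ b, x * b ∈ D}
  add_mem' hx hy b := by rw [add_mul]; exact add_mem (hx b) (hy b)
  zero_mem' b := by simp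
  smul_mem' c x hx b := by
    rw [smul_eq_mul, mul_comm c, mul_assoc]
    exact hx _

lemma isRadical_conductor_frobeniusClosure (p : ℕ) [Fact p.Prime] (A B : Type*) [CommRing A]
    [CommRing B] [Algebra A B] [CharP B p] :
    (frobeniusClosure p A B).conductor.IsRadical := by
  rintro x ⟨k, hk⟩ b
  have hle : k ≤ p ^ k := (Nat.lt_pow_self (Fact.out : p.Prime).one_lt).le
  refine mem_frobeniusClosure_of_pow_mem (n := k) ?_
  rw [mul_pow, ← Nat.sub_add_cancel hle, pow_add x, mul_comm (x ^ _), mul_assoc]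
  exact hk _

/-- If `P` is minimal over the contraction of `I` and `Q` is the only prime over `P`, then every
element of `Q` becomes nilpotent modulo `I` away from `P`. -/
lemma Ideal.exists_algebraMap_mul_pow_mem_of_mem_minimalPrimes {A B : Type*} [CommRing A]
    [CommRing B] [Algebra A B] {I : Ideal B} {P : Ideal A}
    (hP : P ∈ (I.comap (algebraMap A B)).minimalPrimes) {Q : Ideal B}
    (hQ : ∀ Q' : Ideal B, Q'.IsPrime → Q'.comap (algebraMap A B) = P → Q' = Q) {q : B}
    (hq : q ∈ Q) : ∃ s ∉ P, ∃ n : ℕ, algebraMap A B s * q ^ n ∈ I := by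
  have : P.IsPrime := hP.1.1
  by_contra! H
  obtain ⟨Q', hQ', hIQ', hdisj⟩ := I.exists_le_prime_disjoint
    (P.primeCompl.map (algebraMap A B) ⊔ Submonoid.powers q) <| by
      rw [Set.disjoint_right]
      rintro x hx
      obtain ⟨_, ⟨s, hs, rfl⟩, _, ⟨n, rfl⟩, rfl⟩ := Submonoid.mem_sup.mp hx
      exact H s hs n
  rw [Set.disjoint_right] at hdisj
  have hle : Q'.comap (algebraMap A B) ≤ P := fun a ha ↦ by
    by_contra haP
    exact hdisj ((le_sup_left : _ ≤ P.primeCompl.map (algebraMap A B) ⊔ Submonoid.powers q)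
      ⟨a, haP, rfl⟩) ha
  have := hQ Q' hQ' (hle.antisymm (hP.2 ⟨inferInstance, Ideal.comap_mono hIQ'⟩ hle))
  subst this
  exact hdisj ((le_sup_right : _ ≤ P.primeCompl.map (algebraMap A B) ⊔ Submonoid.powers q)
    (Submonoid.mem_powers q)) hq

/-- If ring homomorphisms from `B` to fields are determined by their restriction to `A`, then the
residue field extensions of `B` over `A` are purely inseparable. -/
lemma Ideal.exists_algebraMap_mul_pow_sub_mem (p : ℕ) [Fact p.Prime] {A B : Type u} [CommRing A]
    [CommRing B] [Algebra A B] [CharP A p]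
    (hinj : ∀ (K : Type u) [Field K] (g h : B →+* K),
      g.comp (algebraMap A B) = h.comp (algebraMap A B) → g = h)
    (Q : Ideal B) [Q.IsPrime] (b : B) :
    ∃ s ∉ Q.comap (algebraMap A B), ∃ (n : ℕ) (a : A),
      algebraMap A B s * b ^ p ^ n - algebraMap A B a ∈ Q := by
  set P := Q.comap (algebraMap A B)
  let F := FractionRing (A ⧸ P)
  let E := FractionRing (B ⧸ Q)
  have hj : Function.Injective (Ideal.quotientMap Q (algebraMap A B) (le_refl P)) :=
    Ideal.quotientMap_injective
  let φ : F →+* E := IsFractionRing.map hj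
  algebraize [φ]
  have hφ (a : A) : algebraMap F E (algebraMap (A ⧸ P) F (Ideal.Quotient.mk P a)) =
      algebraMap (B ⧸ Q) E (Ideal.Quotient.mk Q (algebraMap A B a)) := by
    change φ _ = _
    simp [φ, IsFractionRing.map, IsLocalization.map_eq]
  have : IsPurelyInseparable F E := by
    rw [isPurelyInseparable_iff_subsingleton_emb, subsingleton_iff]
    intro σ τ
    have key := hinj _ (σ.toRingHom.comp ((algebraMap (B ⧸ Q) E).comp (Ideal.Quotient.mk Q)))
      (τ.toRingHom.comp ((algebraMap (B ⧸ Q) E).comp (Ideal.Quotient.mk Q))) <| by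
        ext a
        change σ (algebraMap (B ⧸ Q) E (Ideal.Quotient.mk Q (algebraMap A B a))) =
          τ (algebraMap (B ⧸ Q) E (Ideal.Quotient.mk Q (algebraMap A B a)))
        rw [← hφ, AlgHom.commutes, AlgHom.commutes]
    apply AlgHom.coe_ringHom_injective
    apply IsLocalization.ringHom_ext (nonZeroDivisors (B ⧸ Q))
    apply Ideal.Quotient.ringHom_ext
    exact key
  have hpF : CharP F p := by
    rw [CharP.charP_iff_prime_eq_zero Fact.out, ← map_natCast (algebraMap (A ⧸ P) F),
      ← map_natCast (Ideal.Quotient.mk P)]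
    simp
  have : ExpChar F p := .prime Fact.out
  obtain ⟨n, x, hx⟩ := IsPurelyInseparable.pow_mem F p
    (algebraMap (B ⧸ Q) E (Ideal.Quotient.mk Q b))
  obtain ⟨⟨a, s, hs⟩, hxs⟩ := IsLocalization.surj (nonZeroDivisors (A ⧸ P)) x
  obtain ⟨a, rfl⟩ := Ideal.Quotient.mk_surjective a
  obtain ⟨s, rfl⟩ := Ideal.Quotient.mk_surjective s
  refine ⟨s, fun h ↦ nonZeroDivisors.ne_zero hs (Ideal.Quotient.eq_zero_iff_mem.mpr h), n, a, ?_⟩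
  rw [← Ideal.Quotient.eq_zero_iff_mem, map_sub, sub_eq_zero]
  apply IsFractionRing.injective (B ⧸ Q) E
  rw [← hφ]
  dsimp at hxs
  rw [← hxs, map_mul, map_mul, map_mul, hφ, hx, map_pow, map_pow, mul_comm]

/-- A finite ring homomorphism in characteristic `p` which is bijective on prime ideals and has
purely inseparable residue field extensions contains some `p`-power powers in its image. -/
theorem exists_forall_pow_mem_range_algebraMap (p : ℕ) [Fact p.Prime] {A B : Type u} [CommRing A]
    [CommRing B] [Algebra A B] [Module.Finite A B] [CharP A p] [CharP B p]
    (hinj : ∀ (K : Type u) [Field K] (g h : B →+* K),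
      g.comp (algebraMap A B) = h.comp (algebraMap A B) → g = h)
    (hbij : Function.Bijective (PrimeSpectrum.comap (algebraMap A B))) :
    ∃ n : ℕ, ∀ b : B, b ^ p ^ n ∈ (algebraMap A B).range := by
  set D := frobeniusClosure p A B
  obtain ⟨t, ht⟩ : (⊤ : Submodule A B).FG := Module.Finite.fg_top
  have htop : D.conductor = ⊤ := by
    by_contra hne
    obtain ⟨⟨P, hP⟩⟩ := Ideal.nonempty_minimalPrimes
      (I := D.conductor.comap (algebraMap A B)) (Ideal.comap_ne_top _ hne)
    have hPprime : P.IsPrime := hP.1.1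
    obtain ⟨⟨Q, hQ⟩, hQP⟩ := hbij.2 ⟨P, hPprime⟩
    have hQP' : Q.comap (algebraMap A B) = P := congr(($hQP).asIdeal)
    have huniq (Q' : Ideal B) (hQ' : Q'.IsPrime) (h : Q'.comap (algebraMap A B) = P) :
        Q' = Q :=
      congr(($(hbij.1 (a₁ := ⟨Q', hQ'⟩) (a₂ := ⟨Q, hQ⟩)
        (PrimeSpectrum.ext (h.trans hQP'.symm)))).asIdeal)
    have hloc (b : B) : ∃ s ∉ P, algebraMap A B s * b ∈ D := by
      obtain ⟨s, hs, n, a, hsa⟩ := Ideal.exists_algebraMap_mul_pow_sub_mem p hinj Q b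
      obtain ⟨r, hr, k, hrk⟩ :=
        Ideal.exists_algebraMap_mul_pow_mem_of_mem_minimalPrimes hP huniq hsa
      have hmem : algebraMap A B r * (algebraMap A B s * b ^ p ^ n - algebraMap A B a) ∈
          D.conductor := by
        refine isRadical_conductor_frobeniusClosure p A B ⟨k + 1, ?_⟩
        convert! D.conductor.mul_mem_left (algebraMap A B r ^ k *
          (algebraMap A B s * b ^ p ^ n - algebraMap A B a)) hrk using 1
        rw [mul_pow]
        ring
      have hmem' : algebraMap A B (r * s) * b ^ p ^ n ∈ D := by
        have := add_mem (hmem 1) (D.algebraMap_mem (r * a))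
        convert! this using 1
        simp only [map_mul]
        ring
      refine ⟨r * s, hPprime.mul_notMem hr (hQP' ▸ hs), ?_⟩
      refine mem_frobeniusClosure_of_pow_mem (n := n) ?_
      rw [mul_pow, ← Nat.sub_add_cancel (Nat.one_le_pow n p (Fact.out : p.Prime).pos), pow_add _ _ 1,
        pow_one, Nat.sub_add_cancel (Nat.one_le_pow n p (Fact.out : p.Prime).pos), mul_assoc]
      exact mul_mem (pow_mem (D.algebraMap_mem _) _) hmem'
    choose s hs hsD using hloc
    have hprod : ∏ b ∈ t, s b ∉ P := by
      rw [hPprime.prod_mem_iff]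
      simpa using fun b _ ↦ hs b
    refine hprod (hP.1.2 fun b ↦ ?_)
    have hb : b ∈ Submodule.span A (t : Set B) := ht ▸ Submodule.mem_top
    induction hb using Submodule.span_induction with
    | mem x hx =>
      classical
      rw [← Finset.prod_erase_mul _ _ hx, map_mul, mul_assoc]
      exact mul_mem (D.algebraMap_mem _) (hsD x)
    | zero => rw [mul_zero]; exact zero_mem _
    | add x y _ _ hx hy => rw [mul_add]; exact add_mem hx hy
    | smul a x _ hx => rw [mul_smul_comm]; exact D.smul_mem hx a
  have hmem (b : B) : b ∈ D := by
    simpa using (show (1 : B) ∈ D.conductor from htop ▸ Submodule.mem_top) b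
  choose n hn using hmem
  refine ⟨t.sup n, fun b ↦ ?_⟩
  have hb : b ∈ Submodule.span A (t : Set B) := ht ▸ Submodule.mem_top
  induction hb using Submodule.span_induction with
  | mem x hx =>
    obtain ⟨k, hk⟩ := Nat.exists_eq_add_of_le (Finset.le_sup (f := n) hx)
    rw [hk, pow_add, pow_mul]
    exact pow_mem (hn x) _
  | zero => rw [zero_pow (pow_ne_zero _ (Fact.out : p.Prime).ne_zero)]; exact zero_mem _
  | add x y _ _ hx hy => rw [add_pow_char_pow]; exact add_mem hx hy
  | smul a x _ hx =>
    rw [Algebra.smul_def, mul_pow]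
    exact mul_mem (pow_mem (RingHom.mem_range_self _ a) _) hx

lemma add_pow_prime_pow_of_natCast_eq_zero {R : Type*} [CommRing R] {p : ℕ} (hp : p.Prime)
    (h : (p : R) = 0) (n : ℕ) (x y : R) : (x + y) ^ p ^ n = x ^ p ^ n + y ^ p ^ n := by
  nontriviality R
  have : Fact p.Prime := ⟨hp⟩
  have : CharP R p := (CharP.charP_iff_prime_eq_zero hp).mpr h
  exact add_pow_char_pow x y p n

/-- If the `p ^ e`-th powers of elements of `B` lie in the image of an injective ring homomorphism
`f : A →+* B` in characteristic `p`, then the `e`-th power of Frobenius factors through `A`. -/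
noncomputable def RingHom.frobeniusLift {A B : Type*} [CommRing A] [CommRing B] (f : A →+* B)
    (hf : Function.Injective f) {p : ℕ} (hp : p.Prime) (hpB : (p : B) = 0) (e : ℕ)
    (h : ∀ b : B, b ^ p ^ e ∈ f.range) : B →+* A where
  toFun b := (h b).choose
  map_one' := hf (by rw [(h 1).choose_spec, map_one, one_pow])
  map_zero' := hf (by
    rw [(h 0).choose_spec, map_zero, zero_pow (pow_ne_zero _ hp.ne_zero)])
  map_mul' x y := hf (by
    rw [map_mul, (h _).choose_spec, (h x).choose_spec, (h y).choose_spec, mul_pow])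
  map_add' x y := hf (by
    rw [map_add, (h _).choose_spec, (h x).choose_spec, (h y).choose_spec,
      add_pow_prime_pow_of_natCast_eq_zero hp hpB])

lemma RingHom.apply_frobeniusLift {A B : Type*} [CommRing A] [CommRing B] (f : A →+* B)
    (hf : Function.Injective f) {p : ℕ} (hp : p.Prime) (hpB : (p : B) = 0) (e : ℕ)
    (h : ∀ b : B, b ^ p ^ e ∈ f.range) (b : B) :
    f (f.frobeniusLift hf hp hpB e h b) = b ^ p ^ e :=
  (h b).choose_spec

section Localization

variable {A B A' B' : Type*} [CommRing A] [CommRing B] [CommRing A'] [CommRing B']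
  [Algebra A A'] [Algebra B B'] {f : A →+* B} {f' : A' →+* B'}

lemma IsLocalization.Away.pow_mem_range (hff' : ∀ x, algebraMap B B' (f x) = f' (algebraMap A A' x))
    (a : A) [IsLocalization.Away a A'] [IsLocalization.Away (f a) B'] {q : ℕ}
    (h : ∀ b, b ^ q ∈ f.range) (b : B') : b ^ q ∈ f'.range := by
  obtain ⟨n, c, hc⟩ := IsLocalization.Away.surj (f a) b
  obtain ⟨y, hy⟩ := h c
  obtain ⟨u, hu⟩ := IsLocalization.Away.algebraMap_isUnit (S := A') a
  refine ⟨algebraMap A A' y * (↑u⁻¹ : A') ^ (n * q), ?_⟩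
  have hu' : f' (↑u⁻¹ : A') * algebraMap B B' (f a) = 1 := by
    rw [hff', ← hu, ← map_mul, Units.inv_mul, map_one]
  rw [map_mul, ← hff', hy, map_pow, ← hc, map_pow, mul_pow, ← pow_mul, mul_assoc, ← mul_pow,
    mul_comm (algebraMap B B' (f a)), hu', one_pow, mul_one]

lemma IsLocalization.Away.exists_pow_mul_mem_range
    (hff' : ∀ x, algebraMap B B' (f x) = f' (algebraMap A A' x))
    (a : A) [IsLocalization.Away a A'] [IsLocalization.Away (f a) B'] {b : B}
    (h : algebraMap B B' b ∈ f'.range) : ∃ n : ℕ, f a ^ n * b ∈ f.range := by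
  obtain ⟨y, hy⟩ := h
  obtain ⟨n, c, hc⟩ := IsLocalization.Away.surj a y
  have : algebraMap B B' (f a ^ n * b) = algebraMap B B' (f c) := by
    rw [hff', ← hc, map_mul, map_mul, hy, map_pow, map_pow, hff', mul_comm]
  obtain ⟨m, hm⟩ := IsLocalization.Away.exists_of_eq (f a) this
  exact ⟨m + n, a ^ m * c, by rw [map_mul, map_pow, ← hm, pow_add, mul_assoc]⟩

end Localization

lemma RingHom.range_mem_of_span_eq_top {A B : Type*} [CommRing A] [CommRing B] (f : A →+* B)
    (s : Set A) (hs : Ideal.span s = ⊤) (b : B) (h : ∀ a ∈ s, ∃ n : ℕ, f a ^ n * b ∈ f.range) :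
    b ∈ f.range := by
  algebraize [f]
  have := Submodule.mem_of_span_eq_top_of_smul_pow_mem (LinearMap.range (Algebra.linearMap A B))
    s hs b fun r ↦ by
      obtain ⟨n, c, hc⟩ := h r r.2
      exact ⟨n, c, by rw [Algebra.smul_def, map_pow]; exact hc⟩
  exact this

namespace AlgebraicGeometry

variable {X Y : Scheme.{u}} (f : X ⟶ Y)

lemma IsAffineOpen.bijective_comap_app [IsAffineHom f] (hf : Function.Bijective f) {V : Y.Opens}
    (hV : IsAffineOpen V) : Function.Bijective (PrimeSpectrum.comap (f.app V).hom) := by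
  have hU := hV.preimage f
  have key (Q : Spec Γ(X, f ⁻¹ᵁ V)) : hV.fromSpec (Spec.map (f.app V) Q) = f (hU.fromSpec Q) := by
    rw [← Scheme.Hom.comp_apply, ← Scheme.Hom.comp_apply, f.app_eq_appLE,
      hV.SpecMap_appLE_fromSpec f hU]
  refine ⟨fun Q Q' h ↦ ?_, fun P ↦ ?_⟩
  · apply hU.fromSpec.isOpenEmbedding.injective
    apply hf.1
    exact (key Q).symm.trans ((congrArg hV.fromSpec h).trans (key Q'))
  · obtain ⟨x, hx⟩ := hf.2 (hV.fromSpec P)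
    have hxU : x ∈ Set.range hU.fromSpec := by
      rw [hU.range_fromSpec]
      change f x ∈ (V : Set Y)
      rw [hx, ← hV.range_fromSpec]
      exact ⟨P, rfl⟩
    obtain ⟨Q, rfl⟩ := hxU
    exact ⟨Q, hV.fromSpec.isOpenEmbedding.injective ((key Q).trans hx)⟩

lemma IsAffineOpen.eq_of_comp_app_eq [IsAffineHom f] [UniversallyInjective f] {V : Y.Opens}
    (hV : IsAffineOpen V) (K : Type u) [Field K] (g h : Γ(X, f ⁻¹ᵁ V) →+* K)
    (hgh : g.comp (f.app V).hom = h.comp (f.app V).hom) : g = h := by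
  have hU := hV.preimage f
  have hinj : ∀ (K : Type u) [Field K],
      Function.Injective (fun g : Spec (.of K) ⟶ X ↦ g ≫ f) :=
    ((tfae_universallyInjective f).out 0 1).mp ‹_›
  have key (g : Γ(X, f ⁻¹ᵁ V) →+* K) : (Spec.map (CommRingCat.ofHom g) ≫ hU.fromSpec) ≫ f =
      Spec.map (CommRingCat.ofHom (g.comp (f.app V).hom)) ≫ hV.fromSpec := by
    rw [Category.assoc, ← hV.SpecMap_appLE_fromSpec f hU le_rfl, ← Spec.map_comp_assoc,
      ← f.app_eq_appLE]
    rfl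
  have : Spec.map (CommRingCat.ofHom g) ≫ hU.fromSpec =
      Spec.map (CommRingCat.ofHom h) ≫ hU.fromSpec :=
    hinj K ((key g).trans (hgh ▸ (key h).symm))
  rw [cancel_mono] at this
  exact congrArg CommRingCat.Hom.hom (Spec.map_injective this)

lemma IsAffineOpen.app_injective_of_bijective [IsAffineHom f] [IsReduced Y]
    (hf : Function.Bijective f) {V : Y.Opens} (hV : IsAffineOpen V) :
    Function.Injective (f.app V).hom := by
  rw [injective_iff_map_eq_zero]
  intro a ha
  suffices h : a ∈ nilradical Γ(Y, V) from (mem_nilradical.mp h).eq_zero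
  rw [nilradical_eq_sInf, Ideal.mem_sInf]
  rintro P hP
  obtain ⟨Q, hQ⟩ := (hV.bijective_comap_app f hf).2 ⟨P, hP⟩
  obtain rfl : Q.asIdeal.comap (f.app V).hom = P := congr(($hQ).asIdeal)
  rw [Ideal.mem_comap, ha]
  exact zero_mem _

lemma IsAffineOpen.exists_forall_pow_mem_range_app (p : ℕ) [Fact p.Prime] [IsFinite f]
    [UniversallyInjective f] [IsReduced Y] (hf : Function.Bijective f) {V : Y.Opens}
    (hV : IsAffineOpen V) (hp : (p : Γ(Y, V)) = 0) :
    ∃ n : ℕ, ∀ b, b ^ p ^ n ∈ (f.app V).hom.range := by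
  cases subsingleton_or_nontrivial Γ(X, f ⁻¹ᵁ V)
  · exact ⟨0, fun b ↦ ⟨0, Subsingleton.elim _ _⟩⟩
  · have := (f.app V).hom.domain_nontrivial
    have : CharP Γ(Y, V) p := (CharP.charP_iff_prime_eq_zero Fact.out).mpr hp
    have : CharP Γ(X, f ⁻¹ᵁ V) p := (CharP.charP_iff_prime_eq_zero Fact.out).mpr (by
      rw [← map_natCast (f.app V).hom, hp, map_zero])
    have := f.finite_app V hV
    algebraize [(f.app V).hom]
    exact exists_forall_pow_mem_range_algebraMap p (hV.eq_of_comp_app_eq f)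
      (hV.bijective_comap_app f hf)

lemma IsAffineOpen.pow_mem_range_app_basicOpen [IsAffineHom f] {V : Y.Opens}
    (hV : IsAffineOpen V) (a : Γ(Y, V)) {q : ℕ}
    (h : ∀ b, b ^ q ∈ (f.app V).hom.range) (b : Γ(X, f ⁻¹ᵁ Y.basicOpen a)) :
    b ^ q ∈ (f.app (Y.basicOpen a)).hom.range := by
  let i := homOfLE (Y.basicOpen_le a)
  let j := (TopologicalSpace.Opens.map f.base).map i
  let := (Y.presheaf.map i.op).hom.toAlgebra
  let := (X.presheaf.map j.op).hom.toAlgebra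
  have := hV.isLocalization_of_eq_basicOpen a i rfl
  have := (hV.preimage f).isLocalization_of_eq_basicOpen (f.app V a) j (by
    rw [Scheme.preimage_basicOpen])
  exact IsLocalization.Away.pow_mem_range (f := (f.app V).hom)
    (f' := (f.app (Y.basicOpen a)).hom) (fun x ↦ (congr($(f.naturality i.op) x)).symm) a h b

lemma IsAffineOpen.exists_pow_mul_mem_range_app [IsAffineHom f] {V : Y.Opens}
    (hV : IsAffineOpen V) (a : Γ(Y, V)) {q : ℕ}
    (h : ∀ b, b ^ q ∈ (f.app (Y.basicOpen a)).hom.range) (b : Γ(X, f ⁻¹ᵁ V)) :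
    ∃ n : ℕ, f.app V a ^ n * b ^ q ∈ (f.app V).hom.range := by
  let i := homOfLE (Y.basicOpen_le a)
  let j := (TopologicalSpace.Opens.map f.base).map i
  let := (Y.presheaf.map i.op).hom.toAlgebra
  let := (X.presheaf.map j.op).hom.toAlgebra
  have := hV.isLocalization_of_eq_basicOpen a i rfl
  have := (hV.preimage f).isLocalization_of_eq_basicOpen (f.app V a) j (by
    rw [Scheme.preimage_basicOpen])
  refine IsLocalization.Away.exists_pow_mul_mem_range (f := (f.app V).hom)
    (f' := (f.app (Y.basicOpen a)).hom)
    (fun x ↦ (congr($(f.naturality i.op) x)).symm) a ?_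
  rw [map_pow]
  exact h _

lemma exists_forall_affineOpens_pow_mem_range_app (p : ℕ) [Fact p.Prime] [IsFinite f]
    [UniversallyInjective f] [IsReduced Y] [CompactSpace Y] (hf : Function.Bijective f)
    (hp : (p : Γ(Y, ⊤)) = 0) :
    ∃ e : ℕ, 0 < e ∧ ∀ V : Y.affineOpens, ∀ b : Γ(X, f ⁻¹ᵁ V.1), b ^ p ^ e ∈ (f.app V.1).hom.range := by
  have hpV (V : Y.Opens) : (p : Γ(Y, V)) = 0 := by
    rw [← map_natCast (Y.presheaf.map (homOfLE (le_top : V ≤ ⊤)).op).hom, hp, map_zero]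
  choose n hn using fun V : Y.affineOpens ↦ V.2.exists_forall_pow_mem_range_app f p hf (hpV V.1)
  choose W hW hxW _ using fun y : Y ↦
    exists_isAffineOpen_mem_and_subset (TopologicalSpace.Opens.mem_top y)
  obtain ⟨t, ht⟩ := CompactSpace.elim_nhds_subcover (fun y ↦ (W y : Set Y))
    fun y ↦ (W y).2.mem_nhds (hxW y)
  refine ⟨t.sup (fun y ↦ n ⟨W y, hW y⟩) + 1, by simp, fun V ↦ ?_⟩
  refine of_affine_open_cover
    (P := fun V ↦ ∀ b : Γ(X, f ⁻¹ᵁ V.1), b ^ p ^ (t.sup (fun y ↦ n ⟨W y, hW y⟩) + 1) ∈ (f.app V.1).hom.range)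
    (fun y : t ↦ ⟨W y, hW y⟩) ?_ V (fun U a h ↦ U.2.pow_mem_range_app_basicOpen f a h)
    (fun U s hs h b ↦ ?_) (fun y b ↦ ?_)
  · refine top_le_iff.mp fun x _ ↦ ?_
    obtain ⟨y, hy, hxy⟩ := Set.mem_iUnion₂.mp (ht.ge (Set.mem_univ x))
    exact TopologicalSpace.Opens.mem_iSup.mpr ⟨⟨y, hy⟩, hxy⟩
  · exact RingHom.range_mem_of_span_eq_top _ s hs _ fun a ha ↦
      U.2.exists_pow_mul_mem_range_app f a (h ⟨a, ha⟩) b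
  · obtain ⟨k, hk⟩ := Nat.exists_eq_add_of_le
      ((Finset.le_sup (f := fun y ↦ n ⟨W y, hW y⟩) y.2).trans (Nat.le_succ _))
    rw [Nat.succ_eq_add_one] at hk
    rw [hk, pow_add, pow_mul]
    exact pow_mem (hn ⟨W y, hW y⟩ b) _

lemma SpecMap_apply_eq_self_of_pow {R : CommRingCat.{u}} {φ : R ⟶ R} {q : ℕ} (hq : 0 < q)
    (hφ : ∀ r, φ r = r ^ q) (x : Spec R) : Spec.map φ x = x := by
  apply PrimeSpectrum.ext
  ext r
  change φ r ∈ x.asIdeal ↔ _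
  rw [hφ, x.2.pow_mem_iff_mem _ hq]

/-- An endomorphism that raises functions to the `p ^ e`-th power on all affine opens is a power
of Frobenius. -/
lemma isPowerOfFrobenius_of_forall_affineOpens {p e : ℕ} (hp : p.Prime) {h : Y ⟶ Y}
    (φ : ∀ V : Y.affineOpens, Γ(Y, V.1) ⟶ Γ(Y, V.1)) (hφ : ∀ V a, φ V a = a ^ p ^ e)
    (H : ∀ V : Y.affineOpens, V.2.fromSpec ≫ h = Spec.map (φ V) ≫ V.2.fromSpec) :
    IsPowerOfFrobenius p e h := by
  have base_eq (x : Y) : h.base x = x := by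
    obtain ⟨V, hV, hxV, -⟩ := exists_isAffineOpen_mem_and_subset (TopologicalSpace.Opens.mem_top x)
    rw [← SetLike.mem_coe, ← hV.range_fromSpec] at hxV
    obtain ⟨P, rfl⟩ := hxV
    rw [← Scheme.Hom.comp_apply, H ⟨V, hV⟩, Scheme.Hom.comp_apply,
      SpecMap_apply_eq_self_of_pow (pow_pos hp.pos e) (hφ ⟨V, hV⟩)]
  have le (U : Y.Opens) : U ≤ h ⁻¹ᵁ U := fun x hx ↦ by
    change h.base x ∈ U
    rwa [base_eq]
  have appLE_affine (V : Y.affineOpens) : h.appLE V.1 V.1 (le V.1) = φ V := by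
    have hV : IsAffineOpen V.1 := V.2
    apply Spec.map_injective
    rw [← cancel_mono hV.fromSpec, hV.SpecMap_appLE_fromSpec h hV, H]
  refine ⟨base_eq, le, fun U s ↦ ?_⟩
  refine TopCat.Sheaf.eq_of_locally_eq' Y.sheaf
    (fun V : {V : Y.affineOpens // V.1 ≤ U} ↦ V.1.1) U (fun V ↦ homOfLE V.2) (fun x hx ↦ ?_) _ _
    fun V ↦ ?_
  · obtain ⟨V, hV, hxV, hVU⟩ := exists_isAffineOpen_mem_and_subset hx
    exact TopologicalSpace.Opens.mem_iSup.mpr ⟨⟨⟨V, hV⟩, hVU⟩, hxV⟩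
  · change Y.presheaf.map (homOfLE V.2).op (h.appLE U U (le U) s) =
      Y.presheaf.map (homOfLE V.2).op (s ^ p ^ e)
    rw [map_pow, ← hφ V.1, ← appLE_affine, ← CommRingCat.comp_apply, ← CommRingCat.comp_apply,
      Scheme.Hom.appLE_map, Scheme.Hom.map_appLE]

/-- A finite, bijective, universally injective morphism to a reduced quasi-compact scheme of
characteristic `p` factors a power of Frobenius. -/
theorem exists_isPowerOfFrobenius_comp (p : ℕ) [Fact p.Prime] [IsFinite f]
    [UniversallyInjective f] [IsReduced Y] [CompactSpace Y] (hf : Function.Bijective f)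
    (hp : (p : Γ(Y, ⊤)) = 0) :
    ∃ e : ℕ, 0 < e ∧ ∃ g : Y ⟶ X, IsPowerOfFrobenius p e (g ≫ f) := by
  have hpp : p.Prime := Fact.out
  obtain ⟨e, he, h⟩ := exists_forall_affineOpens_pow_mem_range_app f p hf hp
  have hinj (V : Y.affineOpens) := V.2.app_injective_of_bijective f hf
  have hpX (U : X.Opens) : (p : Γ(X, U)) = 0 := by
    rw [← map_natCast (f.appLE ⊤ U le_top).hom, hp, map_zero]
  let φ (V : Y.affineOpens) : Γ(X, f ⁻¹ᵁ V.1) ⟶ Γ(Y, V.1) :=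
    CommRingCat.ofHom ((f.app V.1).hom.frobeniusLift (hinj V) hpp (hpX _) e (h V))
  have hφ (V : Y.affineOpens) (b : Γ(X, f ⁻¹ᵁ V.1)) : f.app V.1 (φ V b) = b ^ p ^ e :=
    RingHom.apply_frobeniusLift _ (hinj V) hpp (hpX _) e (h V) b
  have hφres {V W : Y.affineOpens} (hVW : V.1 ≤ W.1) :
      φ W ≫ Y.presheaf.map (homOfLE hVW).op =
        X.presheaf.map ((TopologicalSpace.Opens.map f.base).map (homOfLE hVW)).op ≫ φ V := by
    ext b
    apply hinj V
    change f.app V.1 (Y.presheaf.map (homOfLE hVW).op (φ W b)) = f.app V.1 (φ V _)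
    rw [hφ, ← CommRingCat.comp_apply, f.naturality, CommRingCat.comp_apply, hφ, map_pow]
    rfl
  have compat {V W : Y.affineOpens} (hVW : V.1 ≤ W.1) :
      Y.homOfLE hVW ≫ W.1.toSpecΓ ≫ Spec.map (φ W) ≫ (W.2.preimage f).fromSpec =
        V.1.toSpecΓ ≫ Spec.map (φ V) ≫ (V.2.preimage f).fromSpec := by
    rw [← Scheme.Opens.toSpecΓ_SpecMap_presheaf_map_assoc _ _ hVW, ← Spec.map_comp_assoc,
      hφres hVW, Spec.map_comp_assoc, IsAffineOpen.map_fromSpec]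
  let g : Y ⟶ X := Scheme.OpenCover.glueMorphismsOfLocallyDirected Y.directedAffineCover
    (fun V : Y.affineOpens ↦ V.1.toSpecΓ ≫ Spec.map (φ V) ≫ (V.2.preimage f).fromSpec)
    (fun hVW ↦ compat (leOfHom hVW))
  have hg (V : Y.affineOpens) : V.1.ι ≫ g = V.1.toSpecΓ ≫ Spec.map (φ V) ≫
      (V.2.preimage f).fromSpec :=
    Scheme.OpenCover.map_glueMorphismsOfLocallyDirected Y.directedAffineCover _ _ V
  refine ⟨e, he, g, isPowerOfFrobenius_of_forall_affineOpens hpp (fun V ↦ f.app V.1 ≫ φ V)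
    (fun V a ↦ hinj V ?_) fun V ↦ ?_⟩
  · change f.app V.1 (φ V (f.app V.1 a)) = f.app V.1 (a ^ p ^ e)
    rw [hφ, map_pow]
  · rw [← V.2.isoSpec_inv_ι, Category.assoc, reassoc_of% hg V, ← V.2.isoSpec_hom,
      Iso.inv_hom_id_assoc, Spec.map_comp_assoc, V.2.isoSpec_inv_ι, f.app_eq_appLE,
      V.2.SpecMap_appLE_fromSpec f (V.2.preimage f)]

end AlgebraicGeometry

lemma IsUniversalHomeomorphism.universallyInjective {X Y : Scheme.{u}} {f : X ⟶ Y}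
    (hf : IsUniversalHomeomorphism f) : UniversallyInjective f :=
  ⟨MorphismProperty.universally_mono (fun _ _ _ h ↦ h.injective) _ hf⟩

lemma IsUniversalHomeomorphism.isHomeomorph {X Y : Scheme.{u}} {f : X ⟶ Y}
    (hf : IsUniversalHomeomorphism f) : IsHomeomorph f :=
  hf _ _ _ .of_id_snd

theorem frobenius_factorization_of_finite_universal_homeomorphism
    (p : ℕ) [Fact p.Prime] (k : Type u) [Field k] [PerfectField k] [CharP k p]
    (X Y : Scheme.{u}) (f : X ⟶ Y)
    (sX : X ⟶ Spec (CommRingCat.of k)) (sY : Y ⟶ Spec (CommRingCat.of k))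
    (hcomm : f ≫ sY = sX)
    -- `X`, `Y` are varieties over `k`:
    [IsIntegral X] [IsIntegral Y]
    [AlgebraicGeometry.IsSeparated sX] [AlgebraicGeometry.IsSeparated sY]
    [LocallyOfFiniteType sX] [LocallyOfFiniteType sY]
    [QuasiCompact sX] [QuasiCompact sY]
    -- `f` is a finite universal homeomorphism:
    [IsFinite f] (hf : IsUniversalHomeomorphism f) :
    ∃ e : ℕ, 0 < e ∧ ∃ g : Y ⟶ X, IsPowerOfFrobenius p e (g ≫ f) := by
  have := hf.universallyInjective
  have : CompactSpace Y := QuasiCompact.compactSpace_of_compactSpace sY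
  refine exists_isPowerOfFrobenius_comp f p hf.isHomeomorph.bijective ?_
  rw [← map_natCast ((Scheme.ΓSpecIso (CommRingCat.of k)).inv ≫ sY.appTop).hom,
    CharP.cast_eq_zero k p, map_zero]
end

section
/- Let f : S̃ → S be the normalization of a variety S over a perfect field k of characteristic p > 0. Suppose there exists e > 0 and a factorization of the e-th Frobenius O_S → O_{S̃} → F^e_* O_S through f_* O_{S̃}. Then f is a universal homeomorphism. -/
/-!
STATEMENT 5: Let `f : S̃ → S` be the normalization of a variety `S` over a perfect field
`k` of characteristic `p > 0`.  Suppose there are `e > 0` and a factorization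
`O_S → f_* O_{S̃} → F^e_* O_S` of the `e`-th power of Frobenius through `f_* O_{S̃}`.
Then `f` is a universal homeomorphism.

Formalization: the sheaf-level factorization of `F^e` through the (finite, hence affine)
morphism `f` corresponds to a morphism of schemes `h : S ⟶ S̃` with `h ≫ f` equal to the
`e`-th power of the absolute Frobenius of `S` (identity on points, `p^e`-th power on
sections).  The normalization is a finite dominant surjective morphism from an integral
scheme; the conclusion is that `f` is a universal homeomorphism.
-/

open AlgebraicGeometry CategoryTheory

universe u

/-- If an integral ring homomorphism `ι` into a domain admits a map `φ` back to its source such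
that `φ ∘ ι` is the `q`-th power map, then the range of `ι` contains all `q`-th powers. -/
theorem RingHom.pow_mem_range_of_comp_eq_pow {A B : Type*} [CommRing A] [CommRing B] [IsDomain A]
    [IsDomain B] (ι : A →+* B) (hι : ι.IsIntegral) (φ : B →+* A) (q : ℕ)
    (h : ∀ a, φ (ι a) = a ^ q) (b : B) : b ^ q ∈ ι.range := by
  have hinj : Function.Injective φ := by
    algebraize [ι]
    rw [RingHom.injective_iff_ker_eq_bot]
    refine Ideal.eq_bot_of_comap_eq_bot (R := A) ((Submodule.eq_bot_iff _).2 fun a ha ↦ ?_)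
    rw [Ideal.mem_comap, RingHom.mem_ker] at ha
    exact eq_zero_of_pow_eq_zero ((h a).symm.trans ha)
  exact ⟨φ b, hinj (by rw [h, map_pow])⟩

namespace AlgebraicGeometry

/-- A morphism of affine schemes of characteristic `p` such that the `p ^ e`-th power of every
global section comes from the target is universally injective. -/
theorem UniversallyInjective.of_pow_mem_range_appTop (p e : ℕ) [Fact p.Prime] {X Y : Scheme.{u}}
    [IsAffine X] [IsAffine Y] (f : X ⟶ Y) (hp : (p : Γ(Y, ⊤)) = 0)
    (H : ∀ b, b ^ p ^ e ∈ f.appTop.hom.range) : UniversallyInjective f := by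
  have := UniversallyInjective.respectsIso
  rw [MorphismProperty.arrow_mk_iso_iff @UniversallyInjective (arrowIsoSpecΓOfIsAffine f)]
  refine ((tfae_universallyInjective _).out 0 1).2 ?_
  intro K _ g₁ g₂ hg
  obtain ⟨ψ₁, rfl⟩ := Spec.map_surjective g₁
  obtain ⟨ψ₂, rfl⟩ := Spec.map_surjective g₂
  simp only [← Spec.map_comp] at hg
  replace hg := Spec.map_injective hg
  congr 1
  ext b
  have : CharP K p := (CharP.charP_iff_prime_eq_zero Fact.out).2
    (by simpa using congr((f.appTop ≫ ψ₁).hom $hp))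
  obtain ⟨a, ha⟩ := H b
  refine iterateFrobenius_inj K p e ?_
  simp only [iterateFrobenius_def]
  rw [← map_pow, ← map_pow, ← ha]
  exact congr($hg a)

/-- Surjective, universally injective integral morphisms are universal homeomorphisms. -/
theorem isUniversalHomeomorphism_of_isIntegralHom {X Y : Scheme.{u}} (f : X ⟶ Y) [IsIntegralHom f]
    [Surjective f] [UniversallyInjective f] : IsUniversalHomeomorphism f := by
  intro X' Y' i₁ i₂ f' h
  have : IsIntegralHom f' := MorphismProperty.of_isPullback h.flip ‹_›
  have : Surjective f' := MorphismProperty.of_isPullback h.flip ‹_›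
  have : UniversallyInjective f' := MorphismProperty.of_isPullback h.flip ‹_›
  exact isHomeomorph_iff_continuous_isClosedMap_bijective.2
    ⟨f'.continuous, f'.isClosedMap, f'.injective, f'.surjective⟩

/-- If a power of Frobenius on an integral scheme `S` factors through an integral surjective
morphism `f` from an integral scheme, then on affine opens the range of `f.app U` contains the
corresponding power of every section. -/
theorem pow_mem_range_app_of_isPowerOfFrobenius {p e : ℕ} {X S : Scheme.{u}} (f : X ⟶ S)
    [IsIntegral S] [IsIntegral X] [IsIntegralHom f] [Surjective f] (h : S ⟶ X)
    (hf : IsPowerOfFrobenius p e (h ≫ f)) {U : S.Opens} (hU : IsAffineOpen U)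
    (b : Γ(X, f ⁻¹ᵁ U)) : b ^ p ^ e ∈ (f.app U).hom.range := by
  rcases isEmpty_or_nonempty U with hU' | ⟨⟨x, hx⟩⟩
  · obtain rfl : U = ⊥ := by
      ext x
      exact ⟨fun hx ↦ hU'.elim ⟨x, hx⟩, fun hx ↦ hx.elim⟩
    have : Subsingleton Γ(X, f ⁻¹ᵁ ⊥) := inferInstanceAs (Subsingleton Γ(X, ⊥))
    exact ⟨0, Subsingleton.elim _ _⟩
  · obtain ⟨y, rfl⟩ := f.surjective x
    have : Nonempty U := ⟨⟨_, hx⟩⟩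
    have : Nonempty (f ⁻¹ᵁ U) := ⟨⟨y, hx⟩⟩
    refine RingHom.pow_mem_range_of_comp_eq_pow (f.app U).hom
      (IsIntegralHom.isIntegral_app f U hU) (h.appLE (f ⁻¹ᵁ U) U (hf.le U)).hom _ (fun a ↦ ?_) b
    rw [← hf.app_eq, Scheme.Hom.comp_appLE]
    rfl

end AlgebraicGeometry

theorem normalization_universal_homeomorphism_of_frobenius_factorization
    (p : ℕ) [Fact p.Prime] (k : Type u) [Field k] [PerfectField k] [CharP k p]
    (Stilde S : Scheme.{u}) (f : Stilde ⟶ S)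
    (sS : S ⟶ Spec (CommRingCat.of k)) [LocallyOfFiniteType sS] [QuasiCompact sS]
    [AlgebraicGeometry.IsSeparated sS]
    -- `S` is a variety and `f : S̃ → S` is its normalization: a finite dominant
    -- surjective morphism from the (integral, normal) scheme `S̃`
    [IsIntegral S] [IsIntegral Stilde]
    [IsFinite f] [IsDominant f] [AlgebraicGeometry.Surjective f]
    -- the factorization `O_S → f_* O_{S̃} → F^e_* O_S` of the `e`-th Frobenius
    (hfact : ∃ e : ℕ, 0 < e ∧ ∃ h : S ⟶ Stilde, IsPowerOfFrobenius p e (h ≫ f)) :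
    IsUniversalHomeomorphism f := by
  obtain ⟨e, -, h, hf⟩ := hfact
  suffices UniversallyInjective f from isUniversalHomeomorphism_of_isIntegralHom f
  refine IsZariskiLocalAtTarget.of_forall_exists_morphismRestrict fun x ↦ ?_
  obtain ⟨U, hU, hx, -⟩ := exists_isAffineOpen_mem_and_subset (U := ⊤) (x := x) trivial
  refine ⟨U, hx, ?_⟩
  have : IsAffine U := hU
  have : IsAffine (f ⁻¹ᵁ U).toScheme := hU.preimage f
  refine .of_pow_mem_range_appTop p e _ ?_ fun b ↦ ?_
  · let g := (Scheme.ΓSpecIso (.of k)).inv ≫ (U.ι ≫ sS).appTop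
    exact (map_natCast g.hom p).symm.trans
      (congr(g.hom $(CharP.cast_eq_zero k p)).trans (map_zero g.hom))
  · rw [morphismRestrict_appTop]
    set i := Stilde.presheaf.map (eqToHom (image_morphismRestrict_preimage f U ⊤)).op
    obtain ⟨c, rfl⟩ := (ConcreteCategory.bijective_of_isIso i).2 b
    obtain ⟨a, ha⟩ := pow_mem_range_app_of_isPowerOfFrobenius f h hf
      ((isAffineOpen_top U).image_of_isOpenImmersion U.ι) c
    exact ⟨a, (congr(i.hom $ha)).trans (map_pow i.hom c _)⟩
end
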